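/- arXiv:1701.07363 — 6 statements merged into one kernel-verified Lean document; each statement's English description precedes it below -/
import Mathlib

section
/- Let y : ℕ → ℝ and q : ℕ → ℝ satisfy q(t+1) = max(q(t) + y(t), 0) for all t, with q(t₀) = 0 for some t₀. Suppose |y(t)| ≤ y_max for all t. Then for every J ∈ ℕ, ∑_{t=t₀}^{t₀+J−1} (q(t) − q(t₀))·y(t) ≤ (J²/2)·y_max². -/
/-- A virtual queue started empty stays nonnegative and grows at most linearly. -/
theorem virtual_queue_mem_Icc {y q : ℕ → ℝ} (hrec : ∀ t, q (t + 1) = max (q t + y t) 0)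
    {t₀ : ℕ} (h0 : q t₀ = 0) {M : ℝ} (hy : ∀ t, |y t| ≤ M) (k : ℕ) :
    q (t₀ + k) ∈ Set.Icc 0 (k * M) := by
  induction k with
  | zero => simp [h0]
  | succ k ih =>
    have hM : 0 ≤ M := (abs_nonneg _).trans (hy 0)
    rw [← add_assoc, hrec]
    refine ⟨le_max_right _ _, max_le ?_ (by positivity)⟩
    push_cast
    linarith [ih.2, (abs_le.mp (hy (t₀ + k))).2]

/-- **Cross-term bound in the J-period Lyapunov drift** (eq. (21) in the appendix).
If `q(t+1) = max(q(t) + y(t), 0)` with `q(t₀) = 0` and `|y(t)| ≤ y_max` for all `t`, then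
`∑_{t=t₀}^{t₀+J−1} (q(t) − q(t₀))·y(t) ≤ (J²/2)·y_max²`. -/
theorem cross_term_bound
    (y q : ℕ → ℝ)
    (hrec : ∀ t, q (t + 1) = max (q t + y t) 0)
    (t₀ : ℕ) (h0 : q t₀ = 0)
    (y_max : ℝ) (hy : ∀ t, |y t| ≤ y_max)
    (J : ℕ) :
    ∑ t ∈ Finset.Ico t₀ (t₀ + J), (q t - q t₀) * y t ≤ ((J : ℝ) ^ 2 / 2) * y_max ^ 2 := by
  induction J with
  | zero => simp
  | succ J ih =>
    obtain ⟨hq0, hqJ⟩ := virtual_queue_mem_Icc hrec h0 hy J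
    have hterm : q (t₀ + J) * y (t₀ + J) ≤ J * y_max * y_max :=
      (mul_le_mul_of_nonneg_left (abs_le.mp (hy _)).2 hq0).trans
        (mul_le_mul_of_nonneg_right hqJ ((abs_nonneg _).trans (hy 0)))
    rw [← add_assoc, Finset.sum_Ico_succ_top (Nat.le_add_right _ _), h0, sub_zero]
    rw [h0] at ih
    push_cast
    linarith [sq_nonneg y_max]
end

section
/- Let y : ℕ → ℝ and q : ℕ → ℝ satisfy q(t+1) = max(q(t) + y(t), 0) for all t, with q(0) ≥ 0. Suppose |y(t)| ≤ y_max for all t and U ≥ (1/2)·y_max². Then for every t₀ ∈ ℕ and J ≥ 1, the J-period Lyapunov drift satisfies (1/2)·q(t₀+J)² − (1/2)·q(t₀)² ≤ U·J·(J+1) + q(t₀)·∑_{t=t₀}^{t₀+J−1} y(t) + ∑_{t=t₀}^{t₀+J−1} (q(t) − q(t₀))·y(t), and moreover if q(t₀) = 0 then (1/2)·q(t₀+J)² ≤ U·J·(J+1) + ∑_{t=t₀}^{t₀+J−1} q(t)·y(t) − ∑_{t=t₀}^{t₀+J−1} (1/2)y(t)² + U·J ≤ U·J·(J+1) + ∑_{t=t₀}^{t₀+J−1}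 q(t)·y(t) + U·J. -/
open Finset in
/-- The one-step drift bounds of a queue, summed over a frame of `J` slots. -/
theorem queue_drift_le_sum {y q : ℕ → ℝ} (hrec : ∀ t, q (t + 1) = max (q t + y t) 0)
    (t₀ J : ℕ) :
    (1 / 2) * q (t₀ + J) ^ 2 - (1 / 2) * q t₀ ^ 2
      ≤ (∑ t ∈ Ico t₀ (t₀ + J), (1 / 2) * y t ^ 2) + ∑ t ∈ Ico t₀ (t₀ + J), q t * y t := by
  induction J with
  | zero => simp
  | succ J ih =>
    have hstep : q (t₀ + J + 1) ^ 2 ≤ (q (t₀ + J) + y (t₀ + J)) ^ 2 := by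
      rw [hrec]
      rcases max_cases (q (t₀ + J) + y (t₀ + J)) 0 with ⟨h, -⟩ | ⟨h, -⟩ <;> rw [h]
      simpa using sq_nonneg (q (t₀ + J) + y (t₀ + J))
    rw [← add_assoc, sum_Ico_succ_top (by lia), sum_Ico_succ_top (by lia)]
    linarith


/-- **J-period Lyapunov drift decomposition** (eq. (20) in the appendix).
If `q(t+1) = max(q(t) + y(t), 0)` with `q(0) ≥ 0`, `|y(t)| ≤ y_max` and `U ≥ (1/2)·y_max²`,
then for every frame start `t₀` and frame length `J ≥ 1`, the `J`-period drift satisfies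
the stated decomposition, and when `q(t₀) = 0` the chained bound holds. -/
theorem J_period_drift_decomposition
    (y q : ℕ → ℝ)
    (hrec : ∀ t, q (t + 1) = max (q t + y t) 0)
    (h0 : 0 ≤ q 0)
    (y_max U : ℝ) (hy : ∀ t, |y t| ≤ y_max) (hU : (1 / 2) * y_max ^ 2 ≤ U)
    (t₀ J : ℕ) (hJ : 1 ≤ J) :
    ((1 / 2) * q (t₀ + J) ^ 2 - (1 / 2) * q t₀ ^ 2
        ≤ U * J * (J + 1) + q t₀ * (∑ t ∈ Finset.Ico t₀ (t₀ + J), y t)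
          + ∑ t ∈ Finset.Ico t₀ (t₀ + J), (q t - q t₀) * y t)
    ∧ (q t₀ = 0 →
        (1 / 2) * q (t₀ + J) ^ 2
            ≤ U * J * (J + 1) + (∑ t ∈ Finset.Ico t₀ (t₀ + J), q t * y t)
              - (∑ t ∈ Finset.Ico t₀ (t₀ + J), (1 / 2) * (y t) ^ 2) + U * J
        ∧ U * J * (J + 1) + (∑ t ∈ Finset.Ico t₀ (t₀ + J), q t * y t)
              - (∑ t ∈ Finset.Ico t₀ (t₀ + J), (1 / 2) * (y t) ^ 2) + U * J
            ≤ U * J * (J + 1) + (∑ t ∈ Finset.Ico t₀ (t₀ + J), q t * y t) + U * J) := by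
  have hsq (t : ℕ) : (1 / 2) * y t ^ 2 ≤ U := by
    have := sq_le_sq' (neg_le_of_abs_le (hy t)) (le_of_abs_le (hy t))
    linarith
  have hU0 : 0 ≤ U := le_trans (by positivity) hU
  have hsum : ∑ t ∈ Finset.Ico t₀ (t₀ + J), (1 / 2) * y t ^ 2 ≤ U * J := by
    refine (Finset.sum_le_card_nsmul _ _ U fun t _ => hsq t).trans_eq ?_
    simp [mul_comm]
  have hnonneg : 0 ≤ ∑ t ∈ Finset.Ico t₀ (t₀ + J), (1 / 2) * y t ^ 2 :=
    Finset.sum_nonneg fun t _ => by positivity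
  have hUJ : U * J ≤ U * J * (J + 1) :=
    le_mul_of_one_le_right (by positivity) (by simp)
  have hdrift := queue_drift_le_sum hrec t₀ J
  refine ⟨?_, fun hq => ⟨?_, by linarith⟩⟩
  · simp only [sub_mul, Finset.sum_sub_distrib, ← Finset.mul_sum] at hdrift hsum ⊢
    linarith
  · rw [hq] at hdrift
    linarith
end

section
/- Let y : ℕ → ℝ and q : ℕ → ℝ satisfy q(t+1) = max(q(t) + y(t), 0) for all t, with q(t₀) = 0. Let d, d°, y° : ℕ → ℝ, let V ≥ 0, C ≥ 0, J ≥ 1, D* ∈ ℝ, y_max ≥ 0 and U ≥ (1/2)·y_max². Suppose for every t with t₀ ≤ t < t₀ + J: (i) V·d(t) + q(t)·y(t) ≤ V·d°(t) + q(t)·y°(t) + C (the online decision is a C-approximate minimizer of the drift-plus-penalty expression), (ii) |y(t)| ≤ y_max and |y°(t)| ≤ y_max, and suppose (iii) ∑_{t=t₀}^{t₀+J−1} y°(t) ≤ 0 (the comparator satisfies the per-frame energy budget) and (iv) ∑_{t=t₀}^{t₀+J−1} d°(t) = J·D*. Then (1/2)·q(t₀+J)² + V·∑_{t=t₀}^{t₀+J−1}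 d(t) ≤ U·J·(J+1) + C·J + V·J·D*. -/
/-- A queue started empty with increments bounded by `M` satisfies `0 ≤ q (t₀ + n) ≤ n * M`. -/
theorem virtual_queue_bounds {y q : ℕ → ℝ} (hrec : ∀ t, q (t + 1) = max (q t + y t) 0)
    {t₀ n : ℕ} (h0 : q t₀ = 0) {M : ℝ} (hM : 0 ≤ M)
    (hy : ∀ t, t₀ ≤ t → t < t₀ + n → y t ≤ M) :
    0 ≤ q (t₀ + n) ∧ q (t₀ + n) ≤ n * M := by
  induction n with
  | zero => simp [h0]
  | succ n ih =>
    obtain ⟨-, hle⟩ := ih fun t h₁ h₂ => hy t h₁ (by omega)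
    have hyn := hy (t₀ + n) (by omega) (by omega)
    rw [← add_assoc, hrec]
    refine ⟨le_max_right _ _, max_le ?_ (by positivity)⟩
    push_cast
    linarith

/-- One-step Lyapunov drift bound for the virtual queue. -/
theorem half_sq_max_add_zero_le (a b : ℝ) :
    (1 / 2) * max (a + b) 0 ^ 2 ≤ (1 / 2) * a ^ 2 + a * b + (1 / 2) * b ^ 2 := by
  rcases max_choice (a + b) 0 with h | h <;> rw [h] <;> nlinarith [sq_nonneg (a + b)]

/-- Drift-plus-penalty bound accumulated over `n` periods, for an arbitrary bounded comparator. -/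
theorem drift_plus_penalty_sum_le {y q d dstar ystar : ℕ → ℝ}
    (hrec : ∀ t, q (t + 1) = max (q t + y t) 0) {t₀ n : ℕ} (h0 : q t₀ = 0)
    {V C M U : ℝ} (hM : 0 ≤ M) (hU : (1 / 2) * M ^ 2 ≤ U)
    (hdec : ∀ t, t₀ ≤ t → t < t₀ + n →
      V * d t + q t * y t ≤ V * dstar t + q t * ystar t + C)
    (hy : ∀ t, t₀ ≤ t → t < t₀ + n → |y t| ≤ M ∧ |ystar t| ≤ M) :
    (1 / 2) * q (t₀ + n) ^ 2 + V * ∑ t ∈ Finset.Ico t₀ (t₀ + n), d t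
      ≤ U * n ^ 2 + C * n + V * ∑ t ∈ Finset.Ico t₀ (t₀ + n), dstar t := by
  induction n with
  | zero => simp [h0]
  | succ n ih =>
    have hsum := ih (fun t h₁ h₂ => hdec t h₁ (by omega)) fun t h₁ h₂ => hy t h₁ (by omega)
    obtain ⟨hq, hqle⟩ := virtual_queue_bounds (n := n) hrec h0 hM
      fun t h₁ h₂ => (le_abs_self _).trans (hy t h₁ (by omega)).1
    obtain ⟨hyn, hysn⟩ := hy (t₀ + n) (by omega) (by omega)
    have hdecn := hdec (t₀ + n) (by omega) (by omega)
    have hdrift := half_sq_max_add_zero_le (q (t₀ + n)) (y (t₀ + n))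
    have hysq : y (t₀ + n) ^ 2 ≤ M ^ 2 := sq_le_sq.2 (by rwa [abs_of_nonneg hM])
    have hcross : q (t₀ + n) * ystar (t₀ + n) ≤ n * M * M :=
      (mul_le_mul_of_nonneg_left ((le_abs_self _).trans hysn) hq).trans
        (mul_le_mul_of_nonneg_right hqle hM)
    have hnU : n * ((1 / 2) * M ^ 2) ≤ n * U := mul_le_mul_of_nonneg_left hU n.cast_nonneg
    rw [← add_assoc, Finset.sum_Ico_succ_top (by omega), Finset.sum_Ico_succ_top (by omega), hrec]
    push_cast
    linarith

/-- **Per-frame key inequality** (eq. (22) in the appendix). If the virtual queue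
satisfies `q(t+1) = max(q(t) + y(t), 0)` with `q(t₀) = 0`, the online decision is a
`C`-approximate minimizer of the drift-plus-penalty expression against a comparator
`(d°, y°)` that satisfies the per-frame energy budget and has frame-average delay `D*`,
then `(1/2)·q(t₀+J)² + V·∑ d(t) ≤ U·J·(J+1) + C·J + V·J·D*`. -/
theorem per_frame_key_inequality
    (y q d dstar ystar : ℕ → ℝ)
    (hrec : ∀ t, q (t + 1) = max (q t + y t) 0)
    (t₀ : ℕ) (h0 : q t₀ = 0)
    (V C : ℝ) (hV : 0 ≤ V) (hC : 0 ≤ C)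
    (J : ℕ) (hJ : 1 ≤ J)
    (Dstar y_max U : ℝ) (hy_max : 0 ≤ y_max) (hU : (1 / 2) * y_max ^ 2 ≤ U)
    (hdec : ∀ t, t₀ ≤ t → t < t₀ + J →
      V * d t + q t * y t ≤ V * dstar t + q t * ystar t + C)
    (hy : ∀ t, t₀ ≤ t → t < t₀ + J → |y t| ≤ y_max ∧ |ystar t| ≤ y_max)
    (hbudget : ∑ t ∈ Finset.Ico t₀ (t₀ + J), ystar t ≤ 0)
    (hDstar : ∑ t ∈ Finset.Ico t₀ (t₀ + J), dstar t = J * Dstar) :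
    (1 / 2) * q (t₀ + J) ^ 2 + V * ∑ t ∈ Finset.Ico t₀ (t₀ + J), d t
      ≤ U * J * (J + 1) + C * J + V * J * Dstar := by
  have hsum := drift_plus_penalty_sum_le hrec h0 hy_max hU hdec hy
  have hUJ : 0 ≤ U * J := mul_nonneg (le_trans (by positivity) hU) J.cast_nonneg
  rw [hDstar] at hsum
  linarith
end

section
/- Under the hypotheses of the per-frame key inequality — q(t+1) = max(q(t) + y(t), 0) for all t, q(t₀) = 0, V ≥ 0, C ≥ 0, J ≥ 1, y_max ≥ 0, U ≥ (1/2)·y_max², for every t₀ ≤ t < t₀+J: V·d(t) + q(t)·y(t) ≤ V·d°(t) + q(t)·y°(t) + C, |y(t)| ≤ y_max, |y°(t)| ≤ y_max, ∑_{t=t₀}^{t₀+J−1} y°(t) ≤ 0, ∑_{t=t₀}^{t₀+J−1} d°(t) = J·D*, and d(t) ≥ 0 for all t in the frame — the per-frame energy deviation satisfies ∑_{t=t₀}^{t₀+J−1} y(t) ≤ √(2·U·J·(J+1) + 2·C·J + 2·V·J·D*). -/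
section VirtualQueue

variable {y q : ℕ → ℝ} {t₀ : ℕ}

/-- A virtual queue dominates the accumulated arrivals since a time at which it was empty. -/
theorem sum_le_virtualQueue (hrec : ∀ t, q (t + 1) = max (q t + y t) 0) (h0 : q t₀ = 0)
    (k : ℕ) : ∑ t ∈ Finset.Ico t₀ (t₀ + k), y t ≤ q (t₀ + k) := by
  induction k with
  | zero => simp [h0]
  | succ k ih =>
    rw [← add_assoc, Finset.sum_Ico_succ_top (Nat.le_add_right _ _), hrec]
    exact (add_le_add_left ih _).trans (le_max_left _ _)

theorem virtualQueue_nonneg (hrec : ∀ t, q (t + 1) = max (q t + y t) 0) (h0 : q t₀ = 0)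
    (k : ℕ) : 0 ≤ q (t₀ + k) := by
  cases k with
  | zero => simp [h0]
  | succ k =>
    rw [← add_assoc, hrec]
    exact le_max_right _ _

/-- A virtual queue with bounded arrivals grows at most linearly. -/
theorem virtualQueue_le_mul (hrec : ∀ t, q (t + 1) = max (q t + y t) 0) (h0 : q t₀ = 0)
    {b : ℝ} (hb : 0 ≤ b) (k : ℕ) (hy : ∀ t, t₀ ≤ t → t < t₀ + k → y t ≤ b) :
    q (t₀ + k) ≤ k * b := by
  induction k with
  | zero => simp [h0]
  | succ k ih =>
    have hq := ih fun t h₁ h₂ => hy t h₁ (by omega)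
    have hyk := hy (t₀ + k) (by omega) (by omega)
    rw [← add_assoc, hrec]
    refine max_le ?_ (by positivity)
    push_cast
    linarith

/-- One-step drift of the quadratic Lyapunov function. -/
theorem max_add_zero_sq_le (a b : ℝ) : max (a + b) 0 ^ 2 ≤ a ^ 2 + 2 * (a * b) + b ^ 2 := by
  rcases max_cases (a + b) 0 with ⟨h, -⟩ | ⟨h, -⟩ <;> rw [h]
  · exact le_of_eq (by ring)
  · nlinarith [sq_nonneg (a + b)]

/-- Drift-plus-penalty bound on the squared virtual queue, against a comparator with
arrivals `ystar` and costs `dstar`. -/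
theorem virtualQueue_sq_le {d dstar ystar : ℕ → ℝ} {V C b U : ℝ}
    (hrec : ∀ t, q (t + 1) = max (q t + y t) 0) (h0 : q t₀ = 0)
    (hV : 0 ≤ V) (hb : 0 ≤ b) (hU : (1 / 2) * b ^ 2 ≤ U) (k : ℕ)
    (hdec : ∀ t, t₀ ≤ t → t < t₀ + k →
      V * d t + q t * y t ≤ V * dstar t + q t * ystar t + C)
    (hy : ∀ t, t₀ ≤ t → t < t₀ + k → |y t| ≤ b ∧ |ystar t| ≤ b)
    (hd : ∀ t, t₀ ≤ t → t < t₀ + k → 0 ≤ d t) :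
    q (t₀ + k) ^ 2
      ≤ 2 * U * k * (k + 1) + 2 * C * k + 2 * V * ∑ t ∈ Finset.Ico t₀ (t₀ + k), dstar t := by
  induction k with
  | zero => simp [h0]
  | succ k ih =>
    have hq := ih (fun t h₁ h₂ => hdec t h₁ (by omega)) (fun t h₁ h₂ => hy t h₁ (by omega))
      (fun t h₁ h₂ => hd t h₁ (by omega))
    have hqb : q (t₀ + k) ≤ k * b := virtualQueue_le_mul hrec h0 hb k
      fun t h₁ h₂ => (le_abs_self _).trans (hy t h₁ (by omega)).1
    obtain ⟨hyk, hystar⟩ := hy (t₀ + k) (by omega) (by omega)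
    have hdeck := hdec (t₀ + k) (by omega) (by omega)
    have hVd := mul_nonneg hV (hd (t₀ + k) (by omega) (by omega))
    have hsq : y (t₀ + k) ^ 2 ≤ b ^ 2 := sq_le_sq.mpr (by rwa [abs_of_nonneg hb])
    have hcross : q (t₀ + k) * ystar (t₀ + k) ≤ k * (2 * U) := by
      calc q (t₀ + k) * ystar (t₀ + k) ≤ q (t₀ + k) * b :=
            mul_le_mul_of_nonneg_left ((le_abs_self _).trans hystar)
              (virtualQueue_nonneg hrec h0 k)
        _ ≤ k * b * b := mul_le_mul_of_nonneg_right hqb hb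
        _ = k * b ^ 2 := by ring
        _ ≤ k * (2 * U) := mul_le_mul_of_nonneg_left (by linarith) k.cast_nonneg
    have hU_nonneg : 0 ≤ U := le_trans (by positivity) hU
    have hdrift := max_add_zero_sq_le (q (t₀ + k)) (y (t₀ + k))
    rw [← add_assoc, Finset.sum_Ico_succ_top (Nat.le_add_right _ _), hrec]
    push_cast
    linarith

end VirtualQueue

/-- **Per-frame energy deviation bound** (eq. (24) in the appendix). Under the hypotheses
of the per-frame key inequality, and assuming the online delay costs are nonnegative, the
per-frame energy deviation satisfies
`∑_{t=t₀}^{t₀+J−1} y(t) ≤ √(2·U·J·(J+1) + 2·C·J + 2·V·J·D*)`. -/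
theorem per_frame_energy_deviation_bound
    (y q d dstar ystar : ℕ → ℝ)
    (hrec : ∀ t, q (t + 1) = max (q t + y t) 0)
    (t₀ : ℕ) (h0 : q t₀ = 0)
    (V C : ℝ) (hV : 0 ≤ V) (hC : 0 ≤ C)
    (J : ℕ) (hJ : 1 ≤ J)
    (Dstar y_max U : ℝ) (hy_max : 0 ≤ y_max) (hU : (1 / 2) * y_max ^ 2 ≤ U)
    (hdec : ∀ t, t₀ ≤ t → t < t₀ + J →
      V * d t + q t * y t ≤ V * dstar t + q t * ystar t + C)
    (hy : ∀ t, t₀ ≤ t → t < t₀ + J → |y t| ≤ y_max ∧ |ystar t| ≤ y_max)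
    (hbudget : ∑ t ∈ Finset.Ico t₀ (t₀ + J), ystar t ≤ 0)
    (hDstar : ∑ t ∈ Finset.Ico t₀ (t₀ + J), dstar t = J * Dstar)
    (hd : ∀ t, t₀ ≤ t → t < t₀ + J → 0 ≤ d t) :
    ∑ t ∈ Finset.Ico t₀ (t₀ + J), y t
      ≤ Real.sqrt (2 * U * J * (J + 1) + 2 * C * J + 2 * V * J * Dstar) := by
  refine (sum_le_virtualQueue hrec h0 J).trans (Real.le_sqrt_of_sq_le ?_)
  have h := virtualQueue_sq_le hrec h0 hV hy_max hU J hdec hy hd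
  rw [hDstar] at h
  linarith
end

section
/- (Theorem 1, part 1.) Let T = R·J with R, J ≥ 1. Let y, d : ℕ → ℝ and q : ℕ → ℝ satisfy, within each frame r ∈ {0,…,R−1}, the queue recursion q(t+1) = max(q(t) + y(t), 0) for rJ ≤ t < (r+1)J with reset q(rJ) = 0. Suppose there exist y_max ≥ 0, U ≥ (1/2)·y_max², C ≥ 0, and for each frame r a parameter V_r > 0, a comparator (d°, y°) and a value D*_r such that for all rJ ≤ t < (r+1)J: V_r·d(t) + q(t)·y(t) ≤ V_r·d°(t) + q(t)·y°(t) + C, |y(t)| ≤ y_max, |y°(t)| ≤ y_max, ∑_{t=rJ}^{(r+1)J−1} y°(t) ≤ 0, and ∑_{t=rJ}^{(r+1)J−1} d°(t) = J·D*_r. Then the time-average delay cost of the online algorithm satisfies (1/T)·∑_{t=0}^{T−1} d(t) ≤ (1/R)·∑_{r=0}^{R−1} D*_r + ((U·(J+1) + C)/R)·∑_{r=0}^{R−1} 1/V_r. -/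
/-- A virtual queue started at `0` with increments bounded by `Y` is nonnegative, grows at most
linearly, and satisfies the summed drift bound against any comparator bounded by `Y`. -/
lemma queue_drift_bound (n : ℕ) (Q y z : ℕ → ℝ) (Y : ℝ) (h0 : Q 0 = 0)
    (hrec : ∀ k < n, Q (k + 1) = max (Q k + y k) 0)
    (hy : ∀ k < n, |y k| ≤ Y) (hz : ∀ k < n, |z k| ≤ Y) :
    0 ≤ Q n ∧ Q n ≤ n * Y ∧
      ∑ k ∈ Finset.range n, (Q k * z k - Q k * y k) ≤ Y ^ 2 / 2 * n ^ 2 - Q n ^ 2 / 2 := by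
  induction n with
  | zero => simp [h0]
  | succ n ih =>
    obtain ⟨hQ0, hQ, hsum⟩ := ih (fun k hk => hrec k (by omega)) (fun k hk => hy k (by omega))
      (fun k hk => hz k (by omega))
    have hyn := abs_le.mp (hy n (by omega))
    have hzn := abs_le.mp (hz n (by omega))
    have hY : 0 ≤ Y := (abs_nonneg _).trans (hy n (by omega))
    have hy2 : y n ^ 2 ≤ Y ^ 2 := sq_le_sq' hyn.1 hyn.2
    have hsq : max (Q n + y n) 0 ^ 2 ≤ (Q n + y n) ^ 2 := by
      rcases max_cases (Q n + y n) 0 with ⟨h, _⟩ | ⟨h, _⟩ <;> rw [h]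
      simpa using sq_nonneg (Q n + y n)
    have hQz : Q n * z n ≤ n * Y * Y :=
      (mul_le_mul_of_nonneg_left hzn.2 hQ0).trans (mul_le_mul_of_nonneg_right hQ hY)
    rw [Finset.sum_range_succ, hrec n (by omega)]
    push_cast
    refine ⟨le_max_right _ _, max_le (by linarith) (by positivity), ?_⟩
    nlinarith

/-- The summed drift bound over a whole frame, where the queue need not be updated after the last
period. -/
lemma frame_drift_bound (J : ℕ) (Q y z : ℕ → ℝ) (Y : ℝ) (h0 : Q 0 = 0)
    (hrec : ∀ k, k + 1 < J → Q (k + 1) = max (Q k + y k) 0)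
    (hy : ∀ k < J, |y k| ≤ Y) (hz : ∀ k < J, |z k| ≤ Y) :
    ∑ k ∈ Finset.range J, (Q k * z k - Q k * y k) ≤ Y ^ 2 / 2 * J ^ 2 := by
  rcases J with _ | n
  · simp
  have hn := queue_drift_bound (n + 1) (fun k => if k ≤ n then Q k else max (Q n + y n) 0) y z Y
    (by simpa using h0) (fun k hk => ?_) hy hz
  · have hsum : ∑ k ∈ Finset.range (n + 1), (Q k * z k - Q k * y k) =
        ∑ k ∈ Finset.range (n + 1), ((if k ≤ n then Q k else max (Q n + y n) 0) * z k -
          (if k ≤ n then Q k else max (Q n + y n) 0) * y k) := by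
      refine Finset.sum_congr rfl fun k hk => ?_
      rw [if_pos (Nat.lt_succ_iff.mp (Finset.mem_range.mp hk))]
    rw [hsum]
    exact hn.2.2.trans (sub_le_self _ (by positivity))
  · rcases (Nat.lt_succ_iff.mp hk).lt_or_eq with h | rfl
    · simp [h.le, Nat.succ_le_of_lt h, hrec k (by omega)]
    · simp

/-- **Theorem 1, part 1** (delay-cost guarantee of E²M²). The trip of `T = R·J` periods
is partitioned into `R` frames of `J` periods each. Within each frame `r`, the virtual
queue follows `q(t+1) = max(q(t) + y(t), 0)` and is reset to `0` at the frame start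
`q(rJ) = 0`. The online decision in each period is a `C`-approximate minimizer of the
drift-plus-penalty objective with control parameter `V_r > 0`, against a comparator
`(d°, y°)` satisfying the per-frame energy budget `∑ y° ≤ 0` and frame-average delay
`D*_r`. Then the time-average delay satisfies
`(1/T)·∑ d(t) ≤ (1/R)·∑ D*_r + ((U·(J+1) + C)/R)·∑ 1/V_r`. -/
theorem E2M2_average_delay_cost_bound
    (R J : ℕ) (hR : 1 ≤ R) (hJ : 1 ≤ J)
    (y q d dstar ystar : ℕ → ℝ) (V Dstar : ℕ → ℝ)
    (y_max U C : ℝ) (hy_max : 0 ≤ y_max) (hU : (1 / 2) * y_max ^ 2 ≤ U) (hC : 0 ≤ C)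
    (hreset : ∀ r < R, q (r * J) = 0)
    (hrec : ∀ r < R, ∀ t, r * J ≤ t → t + 1 < (r + 1) * J → q (t + 1) = max (q t + y t) 0)
    (hV : ∀ r < R, 0 < V r)
    (hdec : ∀ r < R, ∀ t, r * J ≤ t → t < (r + 1) * J →
      V r * d t + q t * y t ≤ V r * dstar t + q t * ystar t + C)
    (hy : ∀ r < R, ∀ t, r * J ≤ t → t < (r + 1) * J → |y t| ≤ y_max ∧ |ystar t| ≤ y_max)
    (hbudget : ∀ r < R, ∑ t ∈ Finset.Ico (r * J) ((r + 1) * J), ystar t ≤ 0)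
    (hDstar : ∀ r < R, ∑ t ∈ Finset.Ico (r * J) ((r + 1) * J), dstar t = J * Dstar r) :
    (1 / (R * J : ℝ)) * ∑ t ∈ Finset.range (R * J), d t
      ≤ (1 / R) * ∑ r ∈ Finset.range R, Dstar r
        + ((U * (J + 1) + C) / R) * ∑ r ∈ Finset.range R, 1 / V r := by
  have hRpos : (0 : ℝ) < R := by exact_mod_cast hR
  have hJpos : (0 : ℝ) < J := by exact_mod_cast hJ
  have hU0 : 0 ≤ U := le_trans (by positivity) hU
  have hframe : ∀ r < R, ∑ k ∈ Finset.range J, d (r * J + k) ≤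
      J * Dstar r + J * (U * (J + 1) + C) * (1 / V r) := by
    intro r hr
    have hVr := hV r hr
    have hmem : ∀ k < J, r * J + k < (r + 1) * J := fun k hk => by rw [add_mul, one_mul]; omega
    have hdrift := frame_drift_bound J (fun k => q (r * J + k)) (fun k => y (r * J + k))
      (fun k => ystar (r * J + k)) y_max (hreset r hr)
      (fun k hk => hrec r hr (r * J + k) (by omega) (hmem (k + 1) hk))
      (fun k hk => (hy r hr _ (by omega) (hmem k hk)).1)
      (fun k hk => (hy r hr _ (by omega) (hmem k hk)).2)
    have hD := hDstar r hr
    rw [Finset.sum_Ico_eq_sum_range, show (r + 1) * J - r * J = J by rw [add_mul]; omega] at hD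
    have hsum : ∑ k ∈ Finset.range J, V r * d (r * J + k) ≤
        ∑ k ∈ Finset.range J, (V r * dstar (r * J + k) +
          (q (r * J + k) * ystar (r * J + k) - q (r * J + k) * y (r * J + k)) + C) := by
      refine Finset.sum_le_sum fun k hk => ?_
      linarith [hdec r hr (r * J + k) (by omega) (hmem k (Finset.mem_range.mp hk))]
    rw [Finset.sum_add_distrib, Finset.sum_add_distrib, ← Finset.mul_sum, ← Finset.mul_sum, hD,
      Finset.sum_const, Finset.card_range, nsmul_eq_mul] at hsum
    have hUJ : y_max ^ 2 / 2 * (J : ℝ) ^ 2 ≤ U * J ^ 2 :=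
      mul_le_mul_of_nonneg_right (by linarith) (by positivity)
    refine le_of_mul_le_mul_left ?_ hVr
    have hexp : V r * (J * Dstar r + J * (U * (J + 1) + C) * (1 / V r)) =
        V r * (J * Dstar r) + U * J ^ 2 + U * J + J * C := by
      field_simp
      ring
    rw [hexp]
    linarith [mul_nonneg hU0 hJpos.le]
  have htotal : ∑ t ∈ Finset.range (R * J), d t ≤
      J * ∑ r ∈ Finset.range R, Dstar r +
        J * (U * (J + 1) + C) * ∑ r ∈ Finset.range R, 1 / V r := by
    have hsplit : ∑ t ∈ Finset.range (R * J), d t =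
        ∑ r ∈ Finset.range R, ∑ k ∈ Finset.range J, d (r * J + k) := by
      clear * -
      induction R with
      | zero => simp
      | succ n ih => rw [add_mul, one_mul, Finset.sum_range_add, Finset.sum_range_succ, ih]
    rw [hsplit, Finset.mul_sum, Finset.mul_sum, ← Finset.sum_add_distrib]
    exact Finset.sum_le_sum fun r hr => hframe r (Finset.mem_range.mp hr)
  calc (1 / (R * J : ℝ)) * ∑ t ∈ Finset.range (R * J), d t
      ≤ (1 / (R * J : ℝ)) * (J * ∑ r ∈ Finset.range R, Dstar r +
        J * (U * (J + 1) + C) * ∑ r ∈ Finset.range R, 1 / V r) :=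
        mul_le_mul_of_nonneg_left htotal (by positivity)
    _ = _ := by field_simp
end

section
/- (Theorem 1, part 2.) Let T = R·J with R, J ≥ 1, and let b ∈ ℝ with total budget αB = T·b. Let y, d : ℕ → ℝ and q : ℕ → ℝ satisfy, within each frame r ∈ {0,…,R−1}, the queue recursion q(t+1) = max(q(t) + y(t), 0) for rJ ≤ t < (r+1)J with reset q(rJ) = 0, and d(t) ≥ 0 for all t. Suppose there exist y_max ≥ 0, U ≥ (1/2)·y_max², C ≥ 0, and for each frame r a parameter V_r ≥ 0, a comparator (d°, y°) and a value D*_r such that for all rJ ≤ t < (r+1)J: V_r·d(t) + q(t)·y(t) ≤ V_r·d°(t) + q(t)·y°(t) + C, |y(t)| ≤ y_max, |y°(t)| ≤ y_max, ∑_{t=rJ}^{(r+1)J−1} y°(t) ≤ 0, and ∑_{t=rJ}^{(r+1)J−1} d°(t) = J·D*_r. Then the total energy consumption e(t) := y(t) + b satisfies ∑_{t=0}^{T−1} e(t) ≤ αB + ∑_{r=0}^{R−1} √(2·U·J·(J+1) + 2·C·J + 2·V_r·J·D*_r). -/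
/-- The virtual queue started empty and driven by the increments `y`. -/
noncomputable def virtualQueue (y : ℕ → ℝ) : ℕ → ℝ
  | 0 => 0
  | n + 1 => max (virtualQueue y n + y n) 0

lemma virtualQueue_nonneg_s10 (y : ℕ → ℝ) (n : ℕ) : 0 ≤ virtualQueue y n := by
  cases n with
  | zero => exact le_rfl
  | succ n => exact le_max_right _ _

lemma sum_range_le_virtualQueue (y : ℕ → ℝ) (n : ℕ) :
    ∑ j ∈ Finset.range n, y j ≤ virtualQueue y n := by
  induction n with
  | zero => simp [virtualQueue]
  | succ n ih =>
    rw [Finset.sum_range_succ]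
    exact (add_le_add_left ih _).trans (le_max_left _ _)

lemma virtualQueue_le_mul_s10 {y : ℕ → ℝ} {m : ℝ} (hm : 0 ≤ m) {n : ℕ} (hy : ∀ j < n, y j ≤ m) :
    virtualQueue y n ≤ n * m := by
  induction n with
  | zero => simp [virtualQueue]
  | succ n ih =>
    have h := ih fun j hj => hy j (by omega)
    have hn := hy n n.lt_succ_self
    push_cast
    exact max_le (by linarith) (by positivity)

lemma virtualQueue_succ_sq_le (y : ℕ → ℝ) (n : ℕ) :
    virtualQueue y (n + 1) ^ 2 ≤
      virtualQueue y n ^ 2 + 2 * (virtualQueue y n * y n) + y n ^ 2 := by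
  rw [virtualQueue]
  rcases max_cases (virtualQueue y n + y n) 0 with ⟨h, -⟩ | ⟨h, -⟩ <;> rw [h] <;>
    nlinarith [sq_nonneg (virtualQueue y n + y n)]

/-- A virtual queue driven by `C`-approximate drift-plus-penalty minimizers, with nonnegative
penalties `d` and comparators with increments at most `m`, has its square bounded in terms of
the total penalty of the comparators. -/
lemma virtualQueue_sq_le_s10 {y ystar d dstar : ℕ → ℝ} {v m U C : ℝ} (hv : 0 ≤ v) (hm : 0 ≤ m)
    (hU : (1 / 2) * m ^ 2 ≤ U) {n : ℕ} (hd : ∀ j < n, 0 ≤ d j)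
    (hdec : ∀ j < n, v * d j + virtualQueue y j * y j ≤
      v * dstar j + virtualQueue y j * ystar j + C)
    (hy : ∀ j < n, |y j| ≤ m) (hystar : ∀ j < n, ystar j ≤ m) :
    virtualQueue y n ^ 2 ≤
      2 * U * n ^ 2 + 2 * C * n + 2 * v * ∑ j ∈ Finset.range n, dstar j := by
  induction n with
  | zero => simp [virtualQueue]
  | succ n ih =>
    have h := ih (fun j hj => hd j (by omega)) (fun j hj => hdec j (by omega))
      (fun j hj => hy j (by omega)) (fun j hj => hystar j (by omega))
    have hn : n < n + 1 := n.lt_succ_self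
    have hQ : virtualQueue y n ≤ n * m :=
      virtualQueue_le_mul_s10 hm fun j hj => (le_abs_self _).trans (hy j (by omega))
    have hcomp : virtualQueue y n * ystar n ≤ n * (2 * U) :=
      calc virtualQueue y n * ystar n ≤ virtualQueue y n * m :=
            mul_le_mul_of_nonneg_left (hystar n hn) (virtualQueue_nonneg_s10 y n)
        _ ≤ n * m * m := mul_le_mul_of_nonneg_right hQ hm
        _ = n * m ^ 2 := by ring
        _ ≤ n * (2 * U) := mul_le_mul_of_nonneg_left (by linarith) n.cast_nonneg
    have hsq : y n ^ 2 ≤ m ^ 2 := sq_le_sq' (abs_le.mp (hy n hn)).1 (abs_le.mp (hy n hn)).2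
    have hpen : 0 ≤ v * d n := mul_nonneg hv (hd n hn)
    have hdrift := virtualQueue_succ_sq_le y n
    have hstep := hdec n hn
    rw [Finset.sum_range_succ]
    push_cast
    linarith

lemma eq_virtualQueue_of_recursion {q y : ℕ → ℝ} {a J : ℕ} (h0 : q a = 0)
    (hrec : ∀ j, j + 1 < J → q (a + j + 1) = max (q (a + j) + y (a + j)) 0) :
    ∀ j < J, q (a + j) = virtualQueue (fun i => y (a + i)) j := by
  intro j
  induction j with
  | zero => intro _; exact h0
  | succ j ih =>
    intro hj
    rw [← add_assoc, hrec j hj, ih (by omega), virtualQueue]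

lemma sum_range_mul_eq_sum_sum (f : ℕ → ℝ) (R J : ℕ) :
    ∑ t ∈ Finset.range (R * J), f t =
      ∑ r ∈ Finset.range R, ∑ j ∈ Finset.range J, f (r * J + j) := by
  induction R with
  | zero => simp
  | succ R ih => rw [Finset.sum_range_succ, add_mul, one_mul, Finset.sum_range_add, ih]


/-- **Theorem 1, part 2** (energy-consumption guarantee of E²M²). The trip of `T = R·J`
periods is partitioned into `R` frames of `J` periods each; `b = αB/T` is the per-period
energy budget, so `e(t) = y(t) + b` is the actual per-period energy consumption. Within
each frame `r`, the virtual queue follows `q(t+1) = max(q(t) + y(t), 0)` and is reset to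
`0` at the frame start, the delay costs `d(t)` are nonnegative, and the online decision
is a `C`-approximate minimizer of the drift-plus-penalty objective with parameter
`V_r ≥ 0` against a comparator `(d°, y°)` satisfying the per-frame energy budget and
frame-average delay `D*_r`. Then the total energy consumption satisfies
`∑_{t=0}^{T−1} e(t) ≤ αB + ∑_{r=0}^{R−1} √(2·U·J·(J+1) + 2·C·J + 2·V_r·J·D*_r)`. -/
theorem E2M2_total_energy_consumption_bound
    (R J : ℕ) (hR : 1 ≤ R) (hJ : 1 ≤ J)
    (b αB : ℝ) (hαB : αB = (R * J : ℕ) * b)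
    (y q d dstar ystar : ℕ → ℝ) (V Dstar : ℕ → ℝ)
    (y_max U C : ℝ) (hy_max : 0 ≤ y_max) (hU : (1 / 2) * y_max ^ 2 ≤ U) (hC : 0 ≤ C)
    (hreset : ∀ r < R, q (r * J) = 0)
    (hrec : ∀ r < R, ∀ t, r * J ≤ t → t + 1 < (r + 1) * J → q (t + 1) = max (q t + y t) 0)
    (hd : ∀ t, 0 ≤ d t)
    (hV : ∀ r < R, 0 ≤ V r)
    (hdec : ∀ r < R, ∀ t, r * J ≤ t → t < (r + 1) * J →
      V r * d t + q t * y t ≤ V r * dstar t + q t * ystar t + C)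
    (hy : ∀ r < R, ∀ t, r * J ≤ t → t < (r + 1) * J → |y t| ≤ y_max ∧ |ystar t| ≤ y_max)
    (hbudget : ∀ r < R, ∑ t ∈ Finset.Ico (r * J) ((r + 1) * J), ystar t ≤ 0)
    (hDstar : ∀ r < R, ∑ t ∈ Finset.Ico (r * J) ((r + 1) * J), dstar t = J * Dstar r) :
    ∑ t ∈ Finset.range (R * J), (y t + b)
      ≤ αB + ∑ r ∈ Finset.range R,
          Real.sqrt (2 * U * J * (J + 1) + 2 * C * J + 2 * V r * J * Dstar r) := by
  rw [Finset.sum_add_distrib, Finset.sum_const, Finset.card_range, nsmul_eq_mul, ← hαB, add_comm,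
    sum_range_mul_eq_sum_sum]
  refine add_le_add_right (Finset.sum_le_sum fun r hr => ?_) _
  have hr := Finset.mem_range.mp hr
  have hlen : (r + 1) * J = r * J + J := by ring
  have hlt : ∀ j < J, r * J + j < (r + 1) * J := fun j hj => by omega
  have hq := eq_virtualQueue_of_recursion (y := y) (J := J) (hreset r hr)
    fun j hj => hrec r hr (r * J + j) (by omega) (by omega)
  have hsum := hDstar r hr
  rw [Finset.sum_Ico_eq_sum_range, hlen, Nat.add_sub_cancel_left] at hsum
  have hsq := virtualQueue_sq_le_s10 (y := fun j => y (r * J + j)) (ystar := fun j => ystar (r * J + j))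
    (d := fun j => d (r * J + j)) (dstar := fun j => dstar (r * J + j)) (C := C) (n := J)
    (hV r hr) hy_max hU (fun j _ => hd _)
    (fun j hj => by
      rw [← hq j hj]
      exact hdec r hr _ (Nat.le_add_right _ _) (hlt j hj))
    (fun j hj => (hy r hr _ (Nat.le_add_right _ _) (hlt j hj)).1)
    (fun j hj => (le_abs_self _).trans (hy r hr _ (Nat.le_add_right _ _) (hlt j hj)).2)
  rw [hsum] at hsq
  have hUJ : 0 ≤ U * J := mul_nonneg ((by positivity : 0 ≤ (1 / 2) * y_max ^ 2).trans hU)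
    J.cast_nonneg
  exact (sum_range_le_virtualQueue _ J).trans (Real.le_sqrt_of_sq_le (by linarith))
end
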